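/- There exist constants c > 0 and C > 0 such that for all sufficiently large n and all integers 0 ≤ k ≤ √n log n: ∫_{r₀}^{t_{n,k} − (log n)/√n} e^{−n ( V_{n,k}(r) − V_{n,k}(t_{n,k}) )} dr ≤ C e^{−c (log n)²}, where t_{n,k} ∈ [r₀, R₀] is the unique solution of t Q'(t) = 2 − (2k+1)/n. -/

import Mathlib

open MeasureTheory Filter Finset

/-- `V_{n,k}(r) = Q(r) − (2 − (2k+1)/n) log r`. -/
noncomputable def Vnk (Q : ℝ → ℝ) (n k : ℕ) (r : ℝ) : ℝ :=
  Q r - (2 - (2 * (k : ℝ) + 1) / n) * Real.log r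

/-- The rescaled radius `x_n(ξ) = R₀ + ξ/(n R₀ δ log 4)`. -/
noncomputable def xn (R₀ δ : ℝ) (n : ℕ) (ξ : ℝ) : ℝ :=
  R₀ + ξ / (n * R₀ * δ * Real.log 4)

/-- The gap-probability factor
`x_{n,k}(ξ) = (∫_{x_n(ξ)}^{R₀} e^{−n V_{n,k}(r)} dr) / (∫_{r₀}^{R₀} e^{−n V_{n,k}(r)} dr)`. -/
noncomputable def xnk (Q : ℝ → ℝ) (r₀ R₀ δ : ℝ) (n k : ℕ) (ξ : ℝ) : ℝ :=
  (∫ r in (xn R₀ δ n ξ)..R₀, Real.exp (-(n : ℝ) * Vnk Q n k r)) /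
  (∫ r in r₀..R₀, Real.exp (-(n : ℝ) * Vnk Q n k r))

section RadialPotential

variable {Q : ℝ → ℝ}

lemma hasDerivAt_Vnk {r : ℝ} (hr : 0 < r) (hQ : DifferentiableAt ℝ Q r) (n k : ℕ) :
    HasDerivAt (Vnk Q n k) ((r * deriv Q r - (2 - (2 * (k : ℝ) + 1) / n)) / r) r := by
  have h : HasDerivAt (Vnk Q n k) (deriv Q r - (2 - (2 * (k : ℝ) + 1) / n) * r⁻¹) r :=
    hQ.hasDerivAt.sub ((Real.hasDerivAt_log hr.ne').const_mul _)
  rwa [sub_div, mul_div_cancel_left₀ _ hr.ne', div_eq_mul_inv _ r]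

lemma hasDerivAt_mul_deriv (hQ : ContDiffOn ℝ 2 Q (Set.Ioi 0)) {r : ℝ} (hr : 0 < r) :
    HasDerivAt (fun x => x * deriv Q x) (deriv Q r + r * deriv (deriv Q) r) r := by
  have h1 : ContDiffOn ℝ 1 (deriv Q) (Set.Ioi 0) :=
    hQ.deriv_of_isOpen isOpen_Ioi (by norm_num)
  have h2 : HasDerivAt (deriv Q) (deriv (deriv Q) r) r :=
    ((h1.differentiableOn (by norm_num)).differentiableAt (Ioi_mem_nhds hr)).hasDerivAt
  have h : HasDerivAt (fun x => x * deriv Q x) (1 * deriv Q r + r * deriv (deriv Q) r) r :=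
    (hasDerivAt_id r).mul h2
  rwa [one_mul] at h

lemma monotoneOn_mul_deriv (hQ : ContDiffOn ℝ 2 Q (Set.Ioi 0))
    (hsub : ∀ r > (0 : ℝ), 0 ≤ deriv (deriv Q) r + deriv Q r / r) :
    MonotoneOn (fun x => x * deriv Q x) (Set.Ioi 0) := by
  refine monotoneOn_of_hasDerivWithinAt_nonneg (convex_Ioi 0)
    (fun x hx => (hasDerivAt_mul_deriv hQ hx).continuousAt.continuousWithinAt)
    (fun x hx => (hasDerivAt_mul_deriv hQ (interior_subset hx)).hasDerivWithinAt)
    (fun x hx => ?_)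
  have hx : 0 < x := interior_subset hx
  have h := mul_nonneg hx.le (hsub x hx)
  field_simp at h
  linarith

/-- If `x Q'(x)` has derivative at least `a` on `[l, R]`, it grows at least at rate `a` there. -/
lemma mul_sub_le_mul_deriv_sub (hQ : ContDiffOn ℝ 2 Q (Set.Ioi 0)) {a l R x y : ℝ} (hl : 0 < l)
    (ha : ∀ r ∈ Set.Icc l R, a ≤ deriv Q r + r * deriv (deriv Q) r)
    (hx : l ≤ x) (hxy : x ≤ y) (hy : y ≤ R) :
    a * (y - x) ≤ y * deriv Q y - x * deriv Q x := by
  have hd : ∀ r ∈ Set.Icc l R, HasDerivAt (fun x => x * deriv Q x)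
      (deriv Q r + r * deriv (deriv Q) r) r :=
    fun r hr => hasDerivAt_mul_deriv hQ (hl.trans_le hr.1)
  refine (convex_Icc l R).mul_sub_le_image_sub_of_le_deriv
    (fun r hr => (hd r hr).continuousAt.continuousWithinAt)
    (fun r hr => (hd r (interior_subset hr)).differentiableAt.differentiableWithinAt)
    (fun r hr => ?_) x ⟨hx, hxy.trans hy⟩ y ⟨hx.trans hxy, hy⟩ hxy
  rw [(hd r (interior_subset hr)).deriv]
  exact ha r (interior_subset hr)

lemma antitoneOn_Vnk (hQ : ContDiffOn ℝ 2 Q (Set.Ioi 0))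
    (hsub : ∀ r > (0 : ℝ), 0 ≤ deriv (deriv Q) r + deriv Q r / r) {n k : ℕ} {t : ℝ}
    (ht : t * deriv Q t = 2 - (2 * (k : ℝ) + 1) / n) :
    AntitoneOn (Vnk Q n k) (Set.Ioc 0 t) := by
  have hd : ∀ r ∈ Set.Ioc 0 t, HasDerivAt (Vnk Q n k)
      ((r * deriv Q r - (2 - (2 * (k : ℝ) + 1) / n)) / r) r := fun r hr =>
    hasDerivAt_Vnk hr.1
      ((hQ.differentiableOn (by norm_num)).differentiableAt (Ioi_mem_nhds hr.1)) n k
  refine antitoneOn_of_hasDerivWithinAt_nonpos (convex_Ioc 0 t)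
    (fun x hx => (hd x hx).continuousAt.continuousWithinAt)
    (fun x hx => (hd x (interior_subset hx)).hasDerivWithinAt) (fun x hx => ?_)
  have hx : x ∈ Set.Ioc 0 t := interior_subset hx
  have h : x * deriv Q x ≤ t * deriv Q t :=
    monotoneOn_mul_deriv hQ hsub hx.1 (hx.1.trans_le hx.2) hx.2
  exact div_nonpos_of_nonpos_of_nonneg (by linarith) hx.1.le

/-- Quadratic growth of `V_{n,k}` to the left of its critical point `t`. -/
lemma mul_sq_le_Vnk_sub (hQ : ContDiffOn ℝ 2 Q (Set.Ioi 0)) {b l R s t : ℝ} (hl : 0 < l)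
    (hb : 0 ≤ b) (ha : ∀ r ∈ Set.Icc l R, 2 * b * R ≤ deriv Q r + r * deriv (deriv Q) r)
    {n k : ℕ} (ht : t * deriv Q t = 2 - (2 * (k : ℝ) + 1) / n)
    (hs : l ≤ s) (hst : s ≤ t) (htR : t ≤ R) :
    b * (t - s) ^ 2 ≤ Vnk Q n k s - Vnk Q n k t := by
  have hd : ∀ r ∈ Set.Icc s t, HasDerivAt (fun r => Vnk Q n k r - b * (t - r) ^ 2)
      ((r * deriv Q r - (2 - (2 * (k : ℝ) + 1) / n)) / r + 2 * b * (t - r)) r := by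
    intro r hr
    have hr0 : 0 < r := hl.trans_le (hs.trans hr.1)
    have h1 := hasDerivAt_Vnk hr0
      ((hQ.differentiableOn (by norm_num)).differentiableAt (Ioi_mem_nhds hr0)) n k
    have h2 : HasDerivAt (fun x => b * (t - x) ^ 2) (b * (2 * (t - r) ^ 1 * -1)) r := by
      exact_mod_cast (((hasDerivAt_id' r).const_sub t).pow 2).const_mul b
    exact (h1.sub h2).congr_deriv (by ring)
  have hanti : AntitoneOn (fun r => Vnk Q n k r - b * (t - r) ^ 2) (Set.Icc s t) := by
    refine antitoneOn_of_hasDerivWithinAt_nonpos (convex_Icc s t)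
      (fun x hx => (hd x hx).continuousAt.continuousWithinAt)
      (fun x hx => (hd x (interior_subset hx)).hasDerivWithinAt) (fun x hx => ?_)
    have hx : x ∈ Set.Icc s t := interior_subset hx
    have hx0 : 0 < x := hl.trans_le (hs.trans hx.1)
    have h1 := mul_sub_le_mul_deriv_sub hQ hl ha (hs.trans hx.1) hx.2 htR
    have h2 : 2 * b * (t - x) * x ≤ 2 * b * (t - x) * R :=
      mul_le_mul_of_nonneg_left (hx.2.trans htR)
        (mul_nonneg (by linarith) (sub_nonneg.2 hx.2))
    rw [div_add' _ _ _ hx0.ne']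
    exact div_nonpos_of_nonpos_of_nonneg (by linarith) hx0.le
  have h := hanti (Set.left_mem_Icc.2 hst) (Set.right_mem_Icc.2 hst) hst
  simp only [sub_self] at h
  linarith

end RadialPotential

lemma tendsto_log_div_sqrt_natCast :
    Tendsto (fun n : ℕ => Real.log n / Real.sqrt n) atTop (nhds 0) := by
  have h := (isLittleO_log_rpow_atTop (r := 1 / 2) (by norm_num)).tendsto_div_nhds_zero
  simp_rw [← Real.sqrt_eq_rpow] at h
  exact h.comp tendsto_natCast_atTop_atTop

/-- `(2k+1)/n` is small uniformly in `k ≤ √n log n`. -/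
lemma index_div_le {n k : ℕ} (hk : (k : ℝ) ≤ Real.sqrt n * Real.log n) :
    (2 * (k : ℝ) + 1) / n ≤ 2 * (Real.log n / Real.sqrt n) + 1 / n := by
  rcases Nat.eq_zero_or_pos n with rfl | hn
  · simp
  have hn' : (0 : ℝ) < n := by exact_mod_cast hn
  have hs : 0 < Real.sqrt n := Real.sqrt_pos.2 hn'
  have h : Real.log n / Real.sqrt n = Real.sqrt n * Real.log n / n := by
    rw [div_eq_div_iff hs.ne' hn'.ne', mul_right_comm, Real.mul_self_sqrt hn'.le, mul_comm]
  rw [h, add_div, mul_div_assoc]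
  gcongr

/-- The tail of the Laplace approximation is exponentially negligible:
`∫_{r₀}^{t_{n,k} − (log n)/√n} e^{−n (V_{n,k}(r) − V_{n,k}(t_{n,k}))} dr ≤ C e^{−c (log n)²}`,
where `t_{n,k}` solves `t Q'(t) = 2 − (2k+1)/n` in `[r₀, R₀]`. -/
theorem hard_edge_radial_laplace_tail
    (Q : ℝ → ℝ) (r₀ R₀ δ : ℝ)
    (hQ : ContDiffOn ℝ 3 Q (Set.Ioi 0))
    (hsub : ∀ r > (0 : ℝ), 0 ≤ deriv (deriv Q) r + deriv Q r / r)
    (hstrict : ∃ ε > (0 : ℝ), ∀ r ∈ Set.Ioo (R₀ - ε) (R₀ + ε),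
        0 < deriv (deriv Q) r + deriv Q r / r)
    (hr₀ : r₀ = sInf {t : ℝ | 0 < t ∧ ∀ r > t, 0 < deriv Q r})
    (hR₀ : R₀ * deriv Q R₀ = 2)
    (hR₀min : ∀ R > (0 : ℝ), R * deriv Q R = 2 → R₀ ≤ R)
    (hr₀pos : 0 < r₀) (hr₀R₀ : r₀ < R₀)
    (hδ : δ = (1 / 4) * (deriv (deriv Q) R₀ + deriv Q R₀ / R₀)) (hδpos : 0 < δ) :
    ∃ c > (0 : ℝ), ∃ C > (0 : ℝ), ∃ N : ℕ, ∀ n ≥ N, ∀ k : ℕ,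
      (k : ℝ) ≤ Real.sqrt n * Real.log n →
      ∀ t ∈ Set.Icc r₀ R₀, t * deriv Q t = 2 - (2 * (k : ℝ) + 1) / n →
        (∫ r in r₀..(t - Real.log n / Real.sqrt n),
            Real.exp (-(n : ℝ) * (Vnk Q n k r - Vnk Q n k t)))
          ≤ C * Real.exp (-c * (Real.log n) ^ 2) := by
  have hQ2 : ContDiffOn ℝ 2 Q (Set.Ioi 0) := hQ.of_le (by norm_num)
  have hRpos : 0 < R₀ := hr₀pos.trans hr₀R₀
  obtain ⟨l, hl, hlR, ha⟩ : ∃ l, r₀ ≤ l ∧ l < R₀ ∧ ∀ r ∈ Set.Icc l R₀,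
      2 * δ * R₀ ≤ deriv Q r + r * deriv (deriv Q) r := by
    have hQ1 : ContDiffOn ℝ 1 (deriv Q) (Set.Ioi 0) :=
      hQ2.deriv_of_isOpen isOpen_Ioi (by norm_num)
    have hc1 : ContinuousAt (deriv Q) R₀ := hQ1.continuousOn.continuousAt (Ioi_mem_nhds hRpos)
    have hc2 : ContinuousAt (deriv (deriv Q)) R₀ :=
      (hQ1.continuousOn_deriv_of_isOpen isOpen_Ioi le_rfl).continuousAt (Ioi_mem_nhds hRpos)
    have hc : ContinuousAt (fun r => deriv Q r + r * deriv (deriv Q) r) R₀ :=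
      hc1.add (continuousAt_id.mul hc2)
    have hval : 2 * δ * R₀ < deriv Q R₀ + R₀ * deriv (deriv Q) R₀ := by
      have h : deriv Q R₀ + R₀ * deriv (deriv Q) R₀ = 4 * δ * R₀ := by
        rw [hδ]
        field_simp
        ring
      nlinarith [mul_pos hδpos hRpos]
    obtain ⟨ε, hε, hball⟩ := Metric.eventually_nhds_iff.1 (hc.eventually (lt_mem_nhds hval))
    refine ⟨max r₀ (R₀ - ε / 2), le_max_left _ _, max_lt hr₀R₀ (by linarith), fun r hr => ?_⟩
    have h1 := (le_max_right _ _).trans hr.1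
    refine (hball ?_).le
    rw [Real.dist_eq, abs_lt]
    constructor <;> linarith [hr.2]
  have hlpos : 0 < l := hr₀pos.trans_le hl
  set m := (l + R₀) / 2 with hm
  have hlog := tendsto_log_div_sqrt_natCast
  have hidx : Tendsto (fun n : ℕ => 2 * (Real.log n / Real.sqrt n) + 1 / (n : ℝ)) atTop
      (nhds 0) := by
    simpa using (hlog.const_mul 2).add tendsto_one_div_atTop_nhds_zero_nat
  have hgap : 0 < 2 * δ * R₀ * (R₀ - m) :=
    mul_pos (by positivity) (by linarith)
  obtain ⟨N, hN⟩ := eventually_atTop.1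
    ((hidx.eventually (gt_mem_nhds hgap)).and
      ((hlog.eventually (gt_mem_nhds (show 0 < m - l by linarith))).and (eventually_ge_atTop 1)))
  refine ⟨δ, hδpos, R₀, hRpos, N, fun n hn k hk t ht htQ => ?_⟩
  obtain ⟨hn1, hn2, hn3⟩ := hN n hn
  have hn' : (0 : ℝ) < n := by exact_mod_cast hn3
  have htm : m < t := by
    by_contra! htm
    have h1 := mul_sub_le_mul_deriv_sub hQ2 hlpos ha (by linarith) (show m ≤ R₀ by linarith) le_rfl
    have h2 : t * deriv Q t ≤ m * deriv Q m :=
      monotoneOn_mul_deriv hQ2 hsub (hr₀pos.trans_le ht.1) (show 0 < m by linarith) htm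
    linarith [index_div_le hk]
  have hw : 0 ≤ Real.log n / Real.sqrt n :=
    div_nonneg (Real.log_natCast_nonneg n) (Real.sqrt_nonneg _)
  set s := t - Real.log n / Real.sqrt n with hs
  have hls : l ≤ s := by linarith
  have hst : s ≤ t := by linarith
  have hquad := mul_sq_le_Vnk_sub hQ2 hlpos hδpos.le ha htQ hls hst ht.2
  have hsq : (n : ℝ) * (t - s) ^ 2 = Real.log n ^ 2 := by
    rw [hs, sub_sub_cancel, div_pow, Real.sq_sqrt hn'.le]
    field_simp
  have hbound : ∀ r ∈ Set.uIoc r₀ s,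
      ‖Real.exp (-(n : ℝ) * (Vnk Q n k r - Vnk Q n k t))‖ ≤ Real.exp (-δ * Real.log n ^ 2) := by
    intro r hr
    rw [Set.uIoc_of_le (hl.trans hls)] at hr
    rw [Real.norm_eq_abs, Real.abs_exp, Real.exp_le_exp]
    have hr0 : 0 < r := hr₀pos.trans hr.1
    have h1 := antitoneOn_Vnk hQ2 hsub htQ ⟨hr0, hr.2.trans hst⟩ ⟨hlpos.trans_le hls, hst⟩ hr.2
    have h2 := mul_le_mul_of_nonneg_left
      (show δ * (t - s) ^ 2 ≤ Vnk Q n k r - Vnk Q n k t by linarith) hn'.le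
    rw [← hsq]
    linarith
  have hint := (le_abs_self _).trans (intervalIntegral.norm_integral_le_of_norm_le_const hbound)
  refine hint.trans ?_
  rw [mul_comm, abs_of_nonneg (by linarith)]
  exact mul_le_mul_of_nonneg_right (by linarith [ht.2]) (Real.exp_pos _).le
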